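/- arXiv:2402.04138 — 4 statements merged into one kernel-verified Lean document; each statement's English description precedes it below -/
import Mathlib

section
/- Let (𝔱,T) be an admissible dataset with n ≥ 4. Then there exists a best exponential approximation to (𝔱,T) (i.e. the infimum of E(g) over all exponentials g is attained by some exponential) if and only if condition ♠ does not hold. -/
open Real

/-- A function is an exponential if it has the form `t ↦ a·exp(k·t)+b` with `k ≠ 0`. -/
def IsExp (g : ℝ → ℝ) : Prop :=
  ∃ a b k : ℝ, k ≠ 0 ∧ g = fun s => a * Real.exp (k * s) + b

/-- Max-norm approximation error of `f` on the dataset `(t, T)`. -/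
noncomputable def approxErr {n : ℕ} (t T : Fin n → ℝ) (f : ℝ → ℝ) : ℝ :=
  ⨆ i : Fin n, |f (t i) - T i|

/-- Max-norm error of the line `s ↦ a·s+b` on the dataset `(t, T)`. -/
noncomputable def lineErr {n : ℕ} (t T : Fin n → ℝ) (a b : ℝ) : ℝ :=
  ⨆ l : Fin n, |T l - (a * t l + b)|

/-- The dataset `(t, T)` is admissible: the best line `r(t)=a·t+b` has `a < 0`, and there
are indices `i < j < m` where `T i − r(t i) = r(t j) − T j = T m − r(t m) = R` (the max
error), with `−R ≤ r(t l) − T l < R` for `l < i` and `l > m`, and `−R ≤ T l − r(t l) < R`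
for `i < l < m`. -/
def Admissible {n : ℕ} (t T : Fin n → ℝ) : Prop :=
  ∃ a b : ℝ, (∀ c d : ℝ, lineErr t T a b ≤ lineErr t T c d) ∧ a < 0 ∧
    ∃ i j m : Fin n, i < j ∧ j < m ∧
      T i - (a * t i + b) = lineErr t T a b ∧
      (a * t j + b) - T j = lineErr t T a b ∧
      T m - (a * t m + b) = lineErr t T a b ∧
      (∀ l : Fin n, (l < i ∨ m < l) →
        -(lineErr t T a b) ≤ (a * t l + b) - T l ∧ (a * t l + b) - T l < lineErr t T a b) ∧
      (∀ l : Fin n, i < l → l < m →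
        -(lineErr t T a b) ≤ T l - (a * t l + b) ∧ T l - (a * t l + b) < lineErr t T a b)

/-- Condition ♠: `T 0` is the overall maximum and there are indices `0 < i < j` with
`T i` the overall minimum and `T j` the maximum of `T` over the indices `≥ 1`. -/
def Spade {n : ℕ} (hn : 0 < n) (T : Fin n → ℝ) : Prop :=
  (∀ l : Fin n, T l ≤ T ⟨0, hn⟩) ∧
  ∃ i j : Fin n, 0 < (i : ℕ) ∧ i < j ∧
    (∀ l : Fin n, T i ≤ T l) ∧ (∀ l : Fin n, 0 < (l : ℕ) → T l ≤ T j)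

open Filter Topology

lemma approxErr_le_iff {n : ℕ} [NeZero n] {t T : Fin n → ℝ} {f : ℝ → ℝ} {C : ℝ} :
    approxErr t T f ≤ C ↔ ∀ l, |f (t l) - T l| ≤ C :=
  ciSup_le_iff (Set.finite_range _).bddAbove

lemma abs_sub_le_approxErr {n : ℕ} [NeZero n] (t T : Fin n → ℝ) (f : ℝ → ℝ) (l : Fin n) :
    |f (t l) - T l| ≤ approxErr t T f :=
  approxErr_le_iff.1 le_rfl l

lemma approxErr_lt {n : ℕ} [NeZero n] {t T : Fin n → ℝ} {f : ℝ → ℝ} {C : ℝ}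
    (h : ∀ l, |f (t l) - T l| < C) : approxErr t T f < C := by
  obtain ⟨l, hl⟩ := exists_eq_ciSup_of_finite (f := fun i : Fin n => |f (t i) - T i|)
  exact (hl.symm.trans_lt (h l) :)

lemma approxErr_nonneg {n : ℕ} [NeZero n] (t T : Fin n → ℝ) (f : ℝ → ℝ) :
    0 ≤ approxErr t T f :=
  (abs_nonneg _).trans (abs_sub_le_approxErr t T f 0)

lemma lineErr_le_iff {n : ℕ} [NeZero n] {t T : Fin n → ℝ} {a b C : ℝ} :
    lineErr t T a b ≤ C ↔ ∀ l, |T l - (a * t l + b)| ≤ C :=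
  ciSup_le_iff (Set.finite_range _).bddAbove

/-- The slope `(exp y - 1) / y` of the exponential at the origin, continuously extended by `1`. -/
noncomputable def expSlope : ℝ → ℝ := dslope Real.exp 0

lemma expSlope_zero : expSlope 0 = 1 := by
  simp [expSlope]

lemma expSlope_of_ne {y : ℝ} (hy : y ≠ 0) : expSlope y = (Real.exp y - 1) / y := by
  rw [expSlope, dslope_of_ne _ hy, slope_def_field]
  simp

lemma continuous_expSlope : Continuous expSlope := by
  refine continuous_iff_continuousAt.2 fun y => ?_
  rcases eq_or_ne y 0 with rfl | hy
  · exact continuousAt_dslope_same.2 Real.differentiableAt_exp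
  · exact (continuousAt_dslope_of_ne hy).2 Real.continuous_exp.continuousAt

lemma expSlope_pos (y : ℝ) : 0 < expSlope y := by
  rcases lt_trichotomy y 0 with hy | rfl | hy
  · rw [expSlope_of_ne hy.ne]
    exact div_pos_of_neg_of_neg (by linarith [Real.exp_lt_one_iff.2 hy]) hy
  · simp [expSlope_zero]
  · rw [expSlope_of_ne hy.ne']
    exact div_pos (by linarith [Real.one_lt_exp_iff.2 hy]) hy

lemma expSlope_lt {y z : ℝ} (hy : y ≠ 0) (hz : z ≠ 0) (h : y < z) :
    expSlope y < expSlope z := by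
  rw [expSlope_of_ne hy, expSlope_of_ne hz]
  have := strictConvexOn_exp.secant_strict_mono (Set.mem_univ (0 : ℝ)) (Set.mem_univ y)
    (Set.mem_univ z) hy hz h
  simpa using this

/-- The function of `x` with exponential rate `k` (linear when `k = 0`) that takes the value `0`
at `0` and `1` at `L`. -/
noncomputable def expInterp (L k x : ℝ) : ℝ :=
  x * expSlope (k * x) / (L * expSlope (k * L))

lemma continuous_expInterp {L : ℝ} (hL : L ≠ 0) (x : ℝ) :
    Continuous fun k => expInterp L k x := by
  unfold expInterp
  have h1 : Continuous fun k : ℝ => expSlope (k * x) :=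
    continuous_expSlope.comp (by fun_prop)
  have h2 : Continuous fun k : ℝ => expSlope (k * L) :=
    continuous_expSlope.comp (by fun_prop)
  exact (continuous_const.mul h1).div (continuous_const.mul h2)
    fun k => mul_ne_zero hL (expSlope_pos _).ne'

lemma expInterp_zero_rate (L x : ℝ) : expInterp L 0 x = x / L := by
  simp [expInterp, expSlope_zero]

lemma expInterp_of_ne {L k : ℝ} (hk : k ≠ 0) (x : ℝ) :
    expInterp L k x = (Real.exp (k * x) - 1) / (Real.exp (k * L) - 1) := by
  have h : ∀ y, y * expSlope (k * y) = (Real.exp (k * y) - 1) / k := by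
    intro y
    rcases eq_or_ne y 0 with rfl | hy
    · simp
    · rw [expSlope_of_ne (mul_ne_zero hk hy)]
      field_simp
  rw [expInterp, h, h, div_div_div_cancel_right₀ hk]

lemma exp_mul_sub_one_ne_zero {L k : ℝ} (hL : L ≠ 0) (hk : k ≠ 0) :
    Real.exp (k * L) - 1 ≠ 0 := by
  rw [sub_ne_zero, Ne, Real.exp_eq_one_iff]
  exact mul_ne_zero hk hL

lemma isExp_expInterp {L k : ℝ} (hL : L ≠ 0) (hk : k ≠ 0) (u w p : ℝ) :
    IsExp fun s => u + w * expInterp L k (s - p) := by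
  refine ⟨w * Real.exp (-(k * p)) / (Real.exp (k * L) - 1),
    u - w / (Real.exp (k * L) - 1), k, hk, funext fun s => ?_⟩
  have := exp_mul_sub_one_ne_zero hL hk
  rw [expInterp_of_ne hk, show k * (s - p) = -(k * p) + k * s by ring, Real.exp_add]
  field_simp
  ring

lemma exp_eq_expInterp {p q k : ℝ} (hpq : p ≠ q) (hk : k ≠ 0) (a b s : ℝ) :
    a * Real.exp (k * s) + b = (a * Real.exp (k * p) + b) +
      ((a * Real.exp (k * q) + b) - (a * Real.exp (k * p) + b)) *
        expInterp (q - p) k (s - p) := by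
  have hL : q - p ≠ 0 := sub_ne_zero.2 hpq.symm
  have := exp_mul_sub_one_ne_zero hL hk
  rw [expInterp_of_ne hk]
  have h1 : Real.exp (k * s) = Real.exp (k * p) * Real.exp (k * (s - p)) := by
    rw [← Real.exp_add]; ring_nf
  have h2 : Real.exp (k * q) = Real.exp (k * p) * Real.exp (k * (q - p)) := by
    rw [← Real.exp_add]; ring_nf
  rw [h1, h2]
  field_simp
  ring

lemma tendsto_exp_mul_atBot {x : ℝ} (hx : 0 < x) :
    Tendsto (fun k => Real.exp (k * x)) atBot (𝓝 0) :=
  Real.tendsto_exp_atBot.comp (tendsto_id.atBot_mul_const hx)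

lemma tendsto_expInterp_atBot {L x : ℝ} (hL : 0 < L) (hx : 0 < x) :
    Tendsto (fun k => expInterp L k x) atBot (𝓝 1) := by
  have h := ((tendsto_exp_mul_atBot hx).sub_const 1).div
    ((tendsto_exp_mul_atBot hL).sub_const 1) (by norm_num)
  norm_num at h
  refine h.congr' ?_
  filter_upwards [eventually_lt_atBot 0] with k hk
  exact (expInterp_of_ne hk.ne x).symm

lemma tendsto_expInterp_atTop {L x : ℝ} (hL : 0 < L) (hx : x < L) :
    Tendsto (fun k => expInterp L k x) atTop (𝓝 0) := by
  have h0 : ∀ {y : ℝ}, 0 < y → Tendsto (fun k : ℝ => Real.exp (-k * y)) atTop (𝓝 0) :=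
    fun hy => (tendsto_exp_mul_atBot hy).comp tendsto_neg_atTop_atBot
  have h := ((h0 (sub_pos.2 hx)).sub (h0 hL)).div ((h0 hL).const_sub 1) (by norm_num)
  norm_num at h
  refine h.congr' ?_
  filter_upwards [eventually_gt_atTop 0] with k hk
  have h1 := exp_mul_sub_one_ne_zero hL.ne' hk.ne'
  have e1 : Real.exp (-(k * L)) * Real.exp (k * L) = 1 := by
    rw [← Real.exp_add]; simp
  have e2 : Real.exp (-(k * (L - x))) = Real.exp (k * x) * Real.exp (-(k * L)) := by
    rw [← Real.exp_add]; ring_nf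
  have h2 : 1 - Real.exp (-(k * L)) ≠ 0 := by
    intro h
    rw [sub_eq_zero] at h
    rw [← h, one_mul] at e1
    exact h1 (by linarith)
  rw [expInterp_of_ne hk.ne', Pi.div_apply, div_eq_div_iff h2 h1, e2]
  linear_combination (Real.exp (k * x) - 1) * e1

lemma expInterp_gt {L k x : ℝ} (hL : 0 < L) (hk : k < 0) (hx : 0 < x) (hxL : x < L) :
    x / L < expInterp L k x := by
  have h := expSlope_lt (mul_neg_of_neg_of_pos hk hL).ne (mul_neg_of_neg_of_pos hk hx).ne
    (mul_lt_mul_of_neg_left hxL hk)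
  have := expSlope_pos (k * L)
  rw [expInterp, div_lt_div_iff₀ hL (by positivity)]
  have := mul_lt_mul_of_pos_left h (mul_pos hx hL)
  linarith

lemma expInterp_lt {L k x : ℝ} (hL : 0 < L) (hk : k < 0) (hx : x < 0 ∨ L < x) :
    expInterp L k x < x / L := by
  have hx0 : x ≠ 0 := hx.elim LT.lt.ne fun h => (hL.trans h).ne'
  have := expSlope_pos (k * L)
  rw [expInterp, div_lt_div_iff₀ (by positivity) hL]
  rcases hx with h | h
  · have h' := expSlope_lt (mul_neg_of_neg_of_pos hk hL).ne (mul_ne_zero hk.ne hx0)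
      (mul_lt_mul_of_neg_left (h.trans hL) hk)
    have := mul_lt_mul_of_neg_left h' (mul_neg_of_neg_of_pos h hL)
    linarith
  · have h' := expSlope_lt (mul_ne_zero hk.ne hx0) (mul_neg_of_neg_of_pos hk hL).ne
      (mul_lt_mul_of_neg_left h hk)
    have := mul_lt_mul_of_pos_left h' (mul_pos (hL.trans h) hL)
    linarith

/-- If no line, and no limit of exponentials of unbounded rate, does as well as `E`, then a value
`E` that exponentials approach is attained. -/
lemma exists_isExp_approxErr_le {n : ℕ} [NeZero n] {t T : Fin n → ℝ} (ht : StrictMono t)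
    {z : Fin n} (hz0 : 0 < z) {E : ℝ}
    (hE : ∀ E' > E, ∃ f, IsExp f ∧ approxErr t T f < E')
    (hline : ∀ c d, E < lineErr t T c d)
    {l₁ l₂ r₁ r₂ : Fin n} (hl₁ : 0 < l₁) (hl₂ : 0 < l₂) (hl : 2 * E < T l₁ - T l₂)
    (hr₁ : r₁ < z) (hr₂ : r₂ < z) (hr : 2 * E < T r₁ - T r₂) :
    ∃ f, IsExp f ∧ approxErr t T f ≤ E := by
  set L := t z - t 0 with hLdef
  have hL : 0 < L := sub_pos.2 (ht hz0)
  obtain ⟨E', hEE', hl', hr'⟩ : ∃ E', E < E' ∧ 2 * E' < T l₁ - T l₂ ∧ 2 * E' < T r₁ - T r₂ := by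
    obtain ⟨E', h1, h2⟩ := exists_between
      (lt_min (by linarith : E < (T l₁ - T l₂) / 2) (by linarith : E < (T r₁ - T r₂) / 2))
    have := lt_min_iff.1 h2
    exact ⟨E', h1, by linarith [this.1], by linarith [this.2]⟩
  set B := 2 * E' + |T z - T 0| with hB
  have hE'0 : 0 < E' := by
    obtain ⟨f, -, hf⟩ := hE E' hEE'
    exact (approxErr_nonneg t T f).trans_lt hf
  have hBpos : 0 < B := by positivity
  obtain ⟨δ, hδ, hδl, hδr⟩ : ∃ δ > 0, 2 * E' + 2 * (B * δ) < T l₁ - T l₂ ∧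
      2 * E' + 2 * (B * δ) < T r₁ - T r₂ := by
    obtain ⟨η, h1, h2⟩ := exists_between
      (lt_min (by linarith : 0 < (T l₁ - T l₂) / 2 - E') (by linarith : 0 < (T r₁ - T r₂) / 2 - E'))
    have := lt_min_iff.1 h2
    refine ⟨η / B, by positivity, ?_, ?_⟩ <;> rw [mul_div_cancel₀ _ hBpos.ne'] <;>
      linarith [this.1, this.2]
  have hbot : ∀ᶠ k in atBot, ∀ l : Fin n, 0 < l → |expInterp L k (t l - t 0) - 1| < δ := by
    refine eventually_all.2 fun l => ?_
    by_cases h : 0 < l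
    · filter_upwards [Metric.tendsto_nhds.1
        (tendsto_expInterp_atBot hL (sub_pos.2 (ht h))) δ hδ] with k hk _
      exact hk
    · exact Eventually.of_forall fun k h' => absurd h' h
  have htop : ∀ᶠ k in atTop, ∀ l : Fin n, l < z → |expInterp L k (t l - t 0)| < δ := by
    refine eventually_all.2 fun l => ?_
    by_cases h : l < z
    · filter_upwards [Metric.tendsto_nhds.1
        (tendsto_expInterp_atTop hL (sub_lt_sub_right (ht h) (t 0))) δ hδ] with k hk _
      simpa [Real.dist_eq] using hk
    · exact Eventually.of_forall fun k h' => absurd h' h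
  obtain ⟨K₁, hK₁⟩ := eventually_atBot.1 hbot
  obtain ⟨K₂, hK₂⟩ := eventually_atTop.1 htop
  let S : Set (ℝ × ℝ × ℝ) := Set.Icc (T 0 - E') (T 0 + E') ×ˢ
    (Set.Icc (T z - E') (T z + E') ×ˢ Set.Icc K₁ K₂)
  have hS : IsCompact S := isCompact_Icc.prod (isCompact_Icc.prod isCompact_Icc)
  let F : ℝ × ℝ × ℝ → ℝ := fun x =>
    ‖fun l : Fin n => x.1 + (x.2.1 - x.1) * expInterp L x.2.2 (t l - t 0) - T l‖
  have hF : Continuous F := by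
    refine continuous_norm.comp (continuous_pi fun l => ?_)
    have := (continuous_expInterp hL.ne' (t l - t 0)).comp
      (continuous_snd.comp continuous_snd : Continuous fun x : ℝ × ℝ × ℝ => x.2.2)
    exact (continuous_fst.add (((continuous_fst.comp continuous_snd).sub continuous_fst).mul
      this)).sub continuous_const
  have key : ∀ f, IsExp f → approxErr t T f < E' → ∃ x ∈ S, F x ≤ approxErr t T f := by
    rintro f ⟨a, b, k, hk, rfl⟩ hf
    set f : ℝ → ℝ := fun s => a * Real.exp (k * s) + b with hfdef
    have hrep : ∀ s, f s = f (t 0) + (f (t z) - f (t 0)) * expInterp L k (s - t 0) :=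
      fun s => exp_eq_expInterp (ht hz0).ne hk a b s
    have herr : ∀ l, |f (t l) - T l| < E' := fun l =>
      (abs_sub_le_approxErr t T f l).trans_lt hf
    have hu := abs_lt.1 (herr 0)
    have hv := abs_lt.1 (herr z)
    have huv : |f (t z) - f (t 0)| ≤ B := by
      have h1 := le_abs_self (T z - T 0)
      have h2 := neg_abs_le (T z - T 0)
      rw [abs_le]
      constructor <;> linarith
    have spread : ∀ l l' : Fin n, ∀ w : ℝ, |expInterp L k (t l - t 0) - w| < δ →
        |expInterp L k (t l' - t 0) - w| < δ → T l - T l' ≤ 2 * E' + 2 * (B * δ) := by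
      intro l l' w h1 h2
      have e : f (t l) - f (t l') = (f (t z) - f (t 0)) *
          ((expInterp L k (t l - t 0) - w) - (expInterp L k (t l' - t 0) - w)) := by
        rw [hrep (t l), hrep (t l')]
        ring
      have : f (t l) - f (t l') ≤ B * (δ + δ) := by
        refine (le_abs_self _).trans ?_
        rw [e, abs_mul]
        exact mul_le_mul huv ((abs_sub _ _).trans (add_le_add h1.le h2.le)) (abs_nonneg _) hBpos.le
      have h3 := abs_lt.1 (herr l)
      have h4 := abs_lt.1 (herr l')
      linarith
    refine ⟨(f (t 0), f (t z), k), ⟨⟨by linarith, by linarith⟩, ⟨by linarith, by linarith⟩, ?_, ?_⟩,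
      ?_⟩
    · by_contra! h
      have := hK₁ k h.le
      linarith [spread l₁ l₂ 1 (this _ hl₁) (this _ hl₂)]
    · by_contra! h
      have := hK₂ k h.le
      linarith [spread r₁ r₂ 0 (by simpa using this _ hr₁) (by simpa using this _ hr₂)]
    · refine (pi_norm_le_iff_of_nonneg (approxErr_nonneg t T f)).2 fun l => ?_
      rw [← hrep (t l), Real.norm_eq_abs]
      exact abs_sub_le_approxErr t T f l
  have hne : S.Nonempty := by
    obtain ⟨f, hf, hfE⟩ := hE E' hEE'
    obtain ⟨x, hx, -⟩ := key f hf hfE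
    exact ⟨x, hx⟩
  obtain ⟨⟨u, v, k⟩, hxS, hmin⟩ := hS.exists_isMinOn hne hF.continuousOn
  have hxE : F (u, v, k) ≤ E := by
    refine le_of_forall_gt_imp_ge_of_dense fun E'' hE'' => ?_
    obtain ⟨f, hf, hfE⟩ := hE (min E' E'') (lt_min hEE' hE'')
    obtain ⟨y, hyS, hy⟩ := key f hf (hfE.trans_le (min_le_left _ _))
    exact ((hmin hyS).trans hy).trans (hfE.le.trans (min_le_right _ _))
  have hbound : ∀ l, |u + (v - u) * expInterp L k (t l - t 0) - T l| ≤ E := fun l =>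
    (norm_le_pi_norm (fun l : Fin n => u + (v - u) * expInterp L k (t l - t 0) - T l) l).trans hxE
  rcases eq_or_ne k 0 with rfl | hk
  · refine absurd (lineErr_le_iff.2 fun l => ?_)
      (hline ((v - u) / L) (u - (v - u) / L * t 0)).not_ge
    rw [abs_sub_comm]
    refine le_of_eq_of_le ?_ (hbound l)
    rw [expInterp_zero_rate]
    ring_nf
  · exact ⟨_, isExp_expInterp hL.ne' hk u (v - u) (t 0), approxErr_le_iff.2 hbound⟩

lemma lineErr_pos_of_alternating {n : ℕ} {t T : Fin n → ℝ} {a b R : ℝ} {i j m : Fin n}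
    (hij : i < j) (hjm : j < m) (hj : (a * t j + b) - T j = R)
    (hin : ∀ l : Fin n, i < l → l < m → -R ≤ T l - (a * t l + b) ∧ T l - (a * t l + b) < R) :
    0 < R := by
  linarith [(hin j hij hjm).2]

/-- A decreasing line whose residuals have the sign pattern `+ - +` is strictly improved by a
decreasing convex exponential. -/
lemma exists_isExp_approxErr_lt {n : ℕ} [NeZero n] {t T : Fin n → ℝ} (ht : StrictMono t)
    {a b R : ℝ} (ha : a < 0) {i j m : Fin n} (hij : i < j) (hjm : j < m)
    (hi : T i - (a * t i + b) = R) (hj : (a * t j + b) - T j = R)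
    (hm : T m - (a * t m + b) = R)
    (hout : ∀ l : Fin n, (l < i ∨ m < l) →
        -R ≤ (a * t l + b) - T l ∧ (a * t l + b) - T l < R)
    (hin : ∀ l : Fin n, i < l → l < m →
        -R ≤ T l - (a * t l + b) ∧ T l - (a * t l + b) < R) :
    ∃ f, IsExp f ∧ approxErr t T f < R := by
  have hR : 0 < R := lineErr_pos_of_alternating hij hjm hj hin
  obtain ⟨p, hip, hp⟩ : ∃ p, t i < p ∧ ∀ l, i < l → p < t l := by
    let i' : Fin n := ⟨i + 1, by omega⟩
    obtain ⟨p, h1, h2⟩ := exists_between (ht (show i < i' from Nat.lt_succ_self _))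
    exact ⟨p, h1, fun l hl => h2.trans_le (ht.monotone (show i' ≤ l from Nat.succ_le_of_lt hl))⟩
  obtain ⟨q, hq, hqm⟩ : ∃ q, (∀ l, l < m → t l < q) ∧ q < t m := by
    let m' : Fin n := ⟨m - 1, by omega⟩
    obtain ⟨q, h1, h2⟩ := exists_between (ht (show m' < m from Nat.sub_lt (by omega) one_pos))
    exact ⟨q, fun l hl => (ht.monotone (show l ≤ m' from Nat.le_sub_one_of_lt hl)).trans_lt h1, h2⟩
  have hL : 0 < q - p := by linarith [hp j hij, hq j hjm]
  let f : ℝ → ℝ → ℝ := fun k s => (a * p + b) + (a * (q - p)) * expInterp (q - p) k (s - p)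
  have hlim : ∀ l, Tendsto (fun k => f k (t l)) (𝓝[<] 0) (𝓝 (a * t l + b)) := by
    intro l
    have h : Continuous fun k => f k (t l) :=
      continuous_const.add (continuous_const.mul (continuous_expInterp hL.ne' (t l - p)))
    have h0 : f 0 (t l) = a * t l + b := by
      simp only [f, expInterp_zero_rate]
      field_simp
      ring
    rw [← h0]
    exact h.continuousAt.tendsto.mono_left nhdsWithin_le_nhds
  have haL : a * (q - p) < 0 := mul_neg_of_neg_of_pos ha hL
  have hline : ∀ s, a * s + b = (a * p + b) + (a * (q - p)) * ((s - p) / (q - p)) := by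
    intro s
    field_simp
    ring
  have hev : ∀ᶠ k in 𝓝[<] (0 : ℝ), ∀ l, |f k (t l) - T l| < R := by
    refine eventually_all.2 fun l => ?_
    by_cases hl : i < l ∧ l < m
    · obtain ⟨h1, h2⟩ := hin l hl.1 hl.2
      filter_upwards [(hlim l).eventually_const_lt (show T l - R < a * t l + b by linarith),
        self_mem_nhdsWithin] with k hk hk0
      have := mul_lt_mul_of_neg_left (expInterp_gt hL hk0 (sub_pos.2 (hp l hl.1))
        (sub_lt_sub_right (hq l hl.2) p)) haL
      have h3 : f k (t l) < a * t l + b := by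
        rw [hline]
        exact add_lt_add_right this _
      rw [abs_lt]
      constructor <;> linarith
    · obtain ⟨h1, h2⟩ : -R ≤ (a * t l + b) - T l ∧ (a * t l + b) - T l < R := by
        rcases lt_trichotomy l i with h | rfl | h
        · exact hout l (Or.inl h)
        · constructor <;> linarith
        · rcases lt_trichotomy l m with h' | rfl | h'
          · exact absurd ⟨h, h'⟩ hl
          · constructor <;> linarith
          · exact hout l (Or.inr h')
      have hx : t l - p < 0 ∨ q - p < t l - p := by
        by_cases h : i < l
        · right
          have : t m ≤ t l := ht.monotone (not_lt.1 fun h' => hl ⟨h, h'⟩)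
          linarith
        · left
          have : t l ≤ t i := ht.monotone (not_lt.1 h)
          linarith
      filter_upwards [(hlim l).eventually_lt_const (show a * t l + b < T l + R by linarith),
        self_mem_nhdsWithin] with k hk hk0
      have := mul_lt_mul_of_neg_left (expInterp_lt hL hk0 hx) haL
      have h3 : a * t l + b < f k (t l) := by
        rw [hline]
        exact add_lt_add_right this _
      rw [abs_lt]
      constructor <;> linarith
  obtain ⟨k, hk, hk0⟩ := (hev.and self_mem_nhdsWithin).exists
  exact ⟨f k, isExp_expInterp hL.ne' (ne_of_lt hk0) _ _ _, approxErr_lt hk⟩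

/-- If after the first data point the last maximum `P` precedes all other minima, some
exponential does at least as well as a constant does on the data without the first point. -/
lemma exists_isExp_approxErr_le_of_max_before_min {n : ℕ} [NeZero n] {t T : Fin n → ℝ}
    (ht : StrictMono t) {P : Fin n} (hP : 0 < P) {μ : ℝ} (h0 : T P ≤ T 0)
    (hbefore : ∀ l, 0 < l → l < P → μ < T l ∧ T l ≤ T P)
    (hμ : μ ≤ T P) (hafter : ∀ l, P < l → μ ≤ T l ∧ T l < T P) :
    ∃ f, IsExp f ∧ approxErr t T f ≤ (T P - μ) / 2 := by
  set c := (T P + μ) / 2 with hc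
  have hP0 : 0 < t P - t 0 := sub_pos.2 (ht hP)
  let g : ℝ → ℝ → ℝ := fun k s =>
    (Real.exp (k * (s - t 0)) - Real.exp (k * (t P - t 0))) / (1 - Real.exp (k * (t P - t 0)))
  let f : ℝ → ℝ → ℝ := fun k s => c + (T 0 - c) * g k s
  have hc0 : 0 ≤ T 0 - c := by linarith
  have hden : ∀ k < 0, 0 < 1 - Real.exp (k * (t P - t 0)) := fun k hk =>
    sub_pos.2 (Real.exp_lt_one_iff.2 (mul_neg_of_neg_of_pos hk hP0))
  have hlim : ∀ l, 0 < l → Tendsto (fun k => f k (t l)) atBot (𝓝 c) := by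
    intro l hl
    have h := ((((tendsto_exp_mul_atBot (sub_pos.2 (ht hl))).sub
      (tendsto_exp_mul_atBot hP0)).div ((tendsto_exp_mul_atBot hP0).const_sub 1)
      (by norm_num)).const_mul (T 0 - c)).const_add c
    simpa using h
  have hev : ∀ᶠ k in atBot, ∀ l, |f k (t l) - T l| ≤ (T P - μ) / 2 := by
    refine eventually_all.2 fun l => ?_
    rcases (Fin.zero_le l).eq_or_lt with rfl | hl
    · filter_upwards [eventually_lt_atBot 0] with k hk
      have : g k (t 0) = 1 := by
        simp only [g, sub_self, mul_zero, Real.exp_zero]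
        exact div_self (hden k hk).ne'
      simp only [f, this]
      rw [abs_le]
      constructor <;> linarith
    rcases lt_trichotomy l P with h | rfl | h
    · obtain ⟨h1, h2⟩ := hbefore l hl h
      filter_upwards [eventually_lt_atBot 0, (hlim l hl).eventually_lt_const
        (show c < T l + (T P - μ) / 2 by linarith)] with k hk hk'
      have : 0 ≤ g k (t l) := div_nonneg (sub_nonneg.2 (Real.exp_le_exp.2
        (mul_le_mul_of_nonpos_left (sub_le_sub_right (ht h).le _) hk.le))) (hden k hk).le
      have h3 : c ≤ f k (t l) := le_add_of_nonneg_right (mul_nonneg hc0 this)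
      rw [abs_le]
      constructor <;> linarith
    · refine Eventually.of_forall fun k => ?_
      have : f k (t l) = c := by simp [f, g]
      rw [this, abs_le]
      constructor <;> linarith
    · obtain ⟨h1, h2⟩ := hafter l h
      filter_upwards [eventually_lt_atBot 0, (hlim l hl).eventually_const_lt
        (show T l - (T P - μ) / 2 < c by linarith)] with k hk hk'
      have : g k (t l) ≤ 0 := div_nonpos_of_nonpos_of_nonneg (sub_nonpos.2 (Real.exp_le_exp.2
        (mul_le_mul_of_nonpos_left (sub_le_sub_right (ht h).le _) hk.le))) (hden k hk).le
      have h3 : f k (t l) ≤ c := add_le_of_nonpos_right (mul_nonpos_of_nonneg_of_nonpos hc0 this)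
      rw [abs_le]
      constructor <;> linarith
  obtain ⟨k, hk, hk0⟩ := (hev.and (eventually_lt_atBot 0)).exists
  refine ⟨f k, ⟨(T 0 - c) * Real.exp (-(k * t 0)) / (1 - Real.exp (k * (t P - t 0))),
    c - (T 0 - c) * Real.exp (k * (t P - t 0)) / (1 - Real.exp (k * (t P - t 0))), k, hk0.ne,
    funext fun s => ?_⟩, approxErr_le_iff.2 hk⟩
  have := (hden k hk0).ne'
  simp only [f, g]
  rw [show k * (s - t 0) = -(k * t 0) + k * s by ring, Real.exp_add]
  ring

lemma exists_isExp_approxErr_le_add {n : ℕ} [NeZero n] {t T : Fin n → ℝ} (ht : StrictMono t)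
    {c e : ℝ} (he : 0 ≤ e) (h : ∀ l, 0 < l → |c - T l| ≤ e) {ε : ℝ} (hε : 0 < ε) :
    ∃ f, IsExp f ∧ approxErr t T f ≤ e + ε := by
  let f : ℝ → ℝ → ℝ := fun k s => (T 0 - c) * Real.exp (k * (s - t 0)) + c
  have hev : ∀ᶠ k in atBot, ∀ l, |f k (t l) - T l| ≤ e + ε := by
    refine eventually_all.2 fun l => ?_
    rcases (Fin.zero_le l).eq_or_lt with rfl | hl
    · refine Eventually.of_forall fun k => ?_
      simp only [f, sub_self, mul_zero, Real.exp_zero]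
      ring_nf
      simp only [abs_zero]
      positivity
    · have hlim := (tendsto_exp_mul_atBot (sub_pos.2 (ht hl))).const_mul (T 0 - c)
      rw [mul_zero] at hlim
      filter_upwards [Metric.tendsto_nhds.1 hlim ε hε] with k hk
      rw [Real.dist_eq, sub_zero] at hk
      calc |f k (t l) - T l| = |(c - T l) + (T 0 - c) * Real.exp (k * (t l - t 0))| := by
            simp only [f]; ring_nf
        _ ≤ e + ε := (abs_add_le _ _).trans (add_le_add (h l hl) hk.le)
  obtain ⟨k, hk, hk0⟩ := (hev.and (eventually_lt_atBot 0)).exists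
  refine ⟨f k, ⟨(T 0 - c) * Real.exp (-(k * t 0)), c, k, hk0.ne, funext fun s => ?_⟩,
    approxErr_le_iff.2 hk⟩
  simp only [f]
  rw [show k * (s - t 0) = -(k * t 0) + k * s by ring, Real.exp_add]
  ring

lemma coeff_eq_zero_of_not_monotone {a b k s₀ s₁ s₂ : ℝ} (hk : k ≠ 0) (h₀ : s₀ < s₁)
    (h₂ : s₁ < s₂) (h₀' : a * Real.exp (k * s₁) + b ≤ a * Real.exp (k * s₀) + b)
    (h₂' : a * Real.exp (k * s₁) + b ≤ a * Real.exp (k * s₂) + b) : a = 0 := by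
  by_contra ha
  have hle : ∀ x y : ℝ, a * Real.exp (k * x) + b ≤ a * Real.exp (k * y) + b →
      0 ≤ (a * k) * (y - x) := by
    intro x y h
    rcases lt_or_gt_of_ne ha with ha | ha
    · have h1 : Real.exp (k * y) ≤ Real.exp (k * x) := by
        by_contra! h'
        linarith [mul_lt_mul_of_neg_left h' ha]
      nlinarith [Real.exp_le_exp.1 h1]
    · have h1 : Real.exp (k * x) ≤ Real.exp (k * y) := by
        by_contra! h'
        linarith [mul_lt_mul_of_pos_left h' ha]
      nlinarith [Real.exp_le_exp.1 h1]
  have h1 := hle _ _ h₀'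
  have h2 := hle _ _ h₂'
  have : a * k ≠ 0 := mul_ne_zero ha hk
  exact this (le_antisymm (by nlinarith) (by nlinarith))

lemma not_spade_of_exists_best {n : ℕ} [NeZero n] {t T : Fin n → ℝ} (ht : StrictMono t)
    {a b : ℝ} (hbest : ∀ c d : ℝ, lineErr t T a b ≤ lineErr t T c d) (ha : a < 0)
    {i j : Fin n} (hi0 : 0 < i) (hij : i < j) (hmax : ∀ l, T l ≤ T 0) (hi : ∀ l, T i ≤ T l)
    (hj : ∀ l, 0 < l → T l ≤ T j) {f : ℝ → ℝ} (hf : IsExp f)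
    (hfbest : ∀ g : ℝ → ℝ, IsExp g → approxErr t T f ≤ approxErr t T g) : False := by
  set c := (T j + T i) / 2 with hc
  set e := (T j - T i) / 2 with he
  have hfe : approxErr t T f ≤ e := by
    refine le_of_forall_pos_le_add fun ε hε => ?_
    obtain ⟨g, hg, hge⟩ := exists_isExp_approxErr_le_add ht (T := T) (c := c) (e := e)
      (by linarith [hi j]) (fun l hl => by
        rw [abs_le]
        constructor <;> linarith [hi l, hj l hl]) hε
    exact (hfbest g hg).trans hge
  have herr := fun l => abs_le.1 (approxErr_le_iff.1 hfe l)
  obtain ⟨α, β, k, hk, rfl⟩ := hf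
  have hα : α = 0 := coeff_eq_zero_of_not_monotone (b := β) hk (ht hi0) (ht hij)
    (by linarith [herr 0, herr i, hmax j]) (by linarith [herr i, herr j])
  subst hα
  have hT0 : T 0 ≤ T j := by linarith [(herr 0).1, (herr i).2]
  have hle : lineErr t T a b ≤ e := (hbest 0 c).trans <| lineErr_le_iff.2 fun l => by
    rw [abs_le]
    constructor <;> linarith [hmax l, hi l]
  have hl := fun l => abs_le.1 (lineErr_le_iff.1 hle l)
  linarith [(hl i).1, (hl j).2, mul_lt_mul_of_neg_left (ht hij) ha]

lemma exists_best_of_not_spade {n : ℕ} [NeZero n] {t T : Fin n → ℝ} (ht : StrictMono t)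
    (hadm : Admissible t T)
    (hsp : ¬ ((∀ l, T l ≤ T 0) ∧ ∃ i j : Fin n, 0 < i ∧ i < j ∧
      (∀ l, T i ≤ T l) ∧ ∀ l, 0 < l → T l ≤ T j)) :
    ∃ f : ℝ → ℝ, IsExp f ∧ ∀ g : ℝ → ℝ, IsExp g → approxErr t T f ≤ approxErr t T g := by
  obtain ⟨a, b, hbest, ha, i, j, m, hij, hjm, hi, hj, hm, hout, hin⟩ := hadm
  obtain ⟨f₀, hf₀, hf₀R⟩ := exists_isExp_approxErr_lt ht ha hij hjm hi hj hm hout hin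
  set R := lineErr t T a b with hR
  let S := approxErr t T '' {f | IsExp f}
  have hSb : BddBelow S := ⟨0, by rintro _ ⟨f, -, rfl⟩; exact approxErr_nonneg t T f⟩
  have hS : S.Nonempty := ⟨_, f₀, hf₀, rfl⟩
  suffices h : ∃ f, IsExp f ∧ approxErr t T f ≤ sInf S by
    obtain ⟨f, hf, hfS⟩ := h
    exact ⟨f, hf, fun g hg => hfS.trans (csInf_le hSb ⟨g, hg, rfl⟩)⟩
  have hER : sInf S < R := (csInf_le hSb ⟨f₀, hf₀, rfl⟩).trans_lt hf₀R
  have hTij : 2 * R < T i - T j := by linarith [mul_lt_mul_of_neg_left (ht hij) ha]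
  have hj0 : 0 < j := (Fin.zero_le i).trans_lt hij
  obtain ⟨P, hP, hPmax⟩ : ∃ P : Fin n, 0 < P ∧ (∀ l, 0 < l → T l ≤ T P) ∧
      ∀ l, P < l → T l < T P := by
    obtain ⟨P₀, hP₀, hmax⟩ := Finset.exists_max_image (Finset.univ.filter fun l : Fin n => 0 < l)
      T ⟨j, by simpa using hj0⟩
    simp only [Finset.mem_filter, Finset.mem_univ, true_and] at hP₀ hmax
    obtain ⟨P, hP, hlast⟩ := Finset.exists_max_image
      (Finset.univ.filter fun l : Fin n => 0 < l ∧ T l = T P₀) id ⟨P₀, by simpa using hP₀⟩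
    simp only [Finset.mem_filter, Finset.mem_univ, true_and, id] at hP hlast
    refine ⟨P, hP.1, fun l hl => hP.2 ▸ hmax l hl, fun l hl => ?_⟩
    have hl0 := hP.1.trans hl
    rw [hP.2]
    exact (hmax l hl0).lt_of_ne fun h => (hlast l ⟨hl0, h⟩).not_gt hl
  obtain ⟨Q, hQ, hQmin⟩ : ∃ Q : Fin n, 0 < Q ∧ ∀ l, 0 < l → T Q ≤ T l := by
    obtain ⟨Q, hQ, hmin⟩ := Finset.exists_min_image (Finset.univ.filter fun l : Fin n => 0 < l)
      T ⟨j, by simpa using hj0⟩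
    simp only [Finset.mem_filter, Finset.mem_univ, true_and] at hQ hmin
    exact ⟨Q, hQ, hmin⟩
  rcases lt_or_ge (2 * sInf S) (T P - T Q) with h | h
  · let z : Fin n := ⟨n - 1, by omega⟩
    have hz : ∀ l, l ≤ z := fun l => Nat.le_sub_one_of_lt l.2
    have hjz : j < z := hjm.trans_le (hz m)
    refine exists_isExp_approxErr_le ht (hj0.trans hjz) (fun E' hE' => ?_)
      (fun c d => hER.trans_le (hbest c d)) hP hQ h (hij.trans hjz) hjz (by linarith)
    obtain ⟨_, ⟨f, hf, rfl⟩, hfE⟩ := exists_lt_of_csInf_lt hS hE'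
    exact ⟨f, hf, hfE⟩
  · have hi0 : i = 0 := by
      by_contra hne
      linarith [hPmax.1 i (Fin.pos_iff_ne_zero.2 hne), hQmin j hj0]
    subst hi0
    have hPT : T P ≤ T 0 := by linarith [hQmin j hj0]
    have hmax : ∀ l, T l ≤ T 0 := fun l => by
      rcases (Fin.zero_le l).eq_or_lt with rfl | hl
      · exact le_rfl
      · exact (hPmax.1 l hl).trans hPT
    obtain ⟨f, hf, hfE⟩ := exists_isExp_approxErr_le_of_max_before_min ht hP (μ := T Q) hPT
      (fun l hl hlP => ⟨(hQmin l hl).lt_of_ne fun heq => hsp ⟨hmax, l, P, hl, hlP, fun l' => by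
        rcases (Fin.zero_le l').eq_or_lt with rfl | hl'
        · exact hmax l
        · exact heq ▸ hQmin l' hl', hPmax.1⟩, hPmax.1 l hl⟩)
      (hPmax.1 Q hQ) fun l hl => ⟨hQmin l (hP.trans hl), hPmax.2 l hl⟩
    exact ⟨f, hf, by linarith⟩

/-- For an admissible dataset with `n ≥ 4`, a best exponential approximation
exists if and only if condition ♠ does not hold. -/
theorem stmt_15 (n : ℕ) (hn : 4 ≤ n) (t T : Fin n → ℝ) (ht : StrictMono t)
    (hadm : Admissible t T) :
    (∃ f : ℝ → ℝ, IsExp f ∧ ∀ g : ℝ → ℝ, IsExp g → approxErr t T f ≤ approxErr t T g) ↔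
      ¬ Spade (by omega) T := by
  have : NeZero n := ⟨by omega⟩
  constructor
  · rintro ⟨f, hf, hfbest⟩ ⟨hmax, i, j, hi0, hij, hi, hj⟩
    obtain ⟨a, b, hbest, ha, -⟩ := hadm
    exact not_spade_of_exists_best ht hbest ha hi0 hij hmax hi hj hf hfbest
  · intro hsp
    exact exists_best_of_not_spade ht hadm hsp
end

section
/- Let (𝔱,T) be a dataset and suppose there exist indices i_1 < i_2 < i_3 with T_{i_1} = T_{i_3} = max_{1≤l≤n} T_l and T_{i_2} = min_{1≤l≤n} T_l, and write M = max_{1≤l≤n} T_l, m = min_{1≤l≤n} T_l with M > m. Then the constant function c(t) = (M+m)/2 satisfies E(c) = (M−m)/2, and every strictly monotone function f:ℝ→ℝ (strictly increasing or strictly decreasing) satisfies E(f) > (M−m)/2. -/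
open Real

/-- If a dataset has indices `i₁ < i₂ < i₃` with `T i₁ = T i₃ = max T` and
`T i₂ = min T`, and `M = max T > m = min T`, then the constant `(M+m)/2` has error
`(M−m)/2`, while every strictly monotone function has error strictly greater than
`(M−m)/2`. -/
theorem stmt_17 (n : ℕ) (t T : Fin n → ℝ) (ht : StrictMono t)
    (M m : ℝ)
    (hM : M = ⨆ l : Fin n, T l) (hm : m = ⨅ l : Fin n, T l) (hMm : M > m)
    (i₁ i₂ i₃ : Fin n) (h12 : i₁ < i₂) (h23 : i₂ < i₃)
    (hmax1 : T i₁ = M) (hmax3 : T i₃ = M) (hmin2 : T i₂ = m) :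
    (⨆ l : Fin n, |(M + m) / 2 - T l|) = (M - m) / 2 ∧
    ∀ f : ℝ → ℝ, (StrictMono f ∨ StrictAnti f) →
      (M - m) / 2 < ⨆ l : Fin n, |f (t l) - T l| := by
  have hle : ∀ l, T l ≤ M := fun l => hM ▸ le_ciSup (Set.finite_range T).bddAbove l
  have hge : ∀ l, m ≤ T l := fun l => hm ▸ ciInf_le (Set.finite_range T).bddBelow l
  have : Nonempty (Fin n) := ⟨i₁⟩
  refine ⟨le_antisymm (ciSup_le fun l => ?_) ?_, fun f hf => ?_⟩
  · rw [abs_le]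
    constructor <;> linarith [hle l, hge l]
  · have h := le_ciSup (Set.finite_range fun l => |(M + m) / 2 - T l|).bddAbove i₂
    have h' := le_abs_self ((M + m) / 2 - T i₂)
    linarith
  · have herr : ∀ l, |f (t l) - T l| ≤ ⨆ l : Fin n, |f (t l) - T l| :=
      le_ciSup (Set.finite_range fun l => |f (t l) - T l|).bddAbove
    have h₁ := abs_le.mp (herr i₁)
    have h₂ := abs_le.mp (herr i₂)
    have h₃ := abs_le.mp (herr i₃)
    rcases hf with hf | hf
    · linarith [hf (ht h12), h₁.1, h₂.2]
    · linarith [hf (ht h23), h₂.2, h₃.1]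
end

section
/- Let (𝔱,T) be a dataset with n ≥ 3 such that T_1 > max_{2≤l≤n} T_l, and set M' = max_{2≤l≤n} T_l, m' = min_{2≤l≤n} T_l with M' > m'. Suppose there exist indices 2 ≤ i < j ≤ n with T_i = m' and T_j = M' (i.e. condition ♠ holds). Then every strictly decreasing function f:ℝ→ℝ satisfies E(f) > (M'−m')/2. -/
open Real

/-- Let `(t, T)` be a dataset with `n ≥ 3` such that `T 0` is strictly
greater than every later value, and let `M'`, `m'` be the maximum and minimum of `T` over
the indices `≥ 1`, with `M' > m'`. If there are indices `0 < i < j` with `T i = m'` and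
`T j = M'` (condition ♠), then every strictly decreasing function `f` has error
`E(f) > (M'−m')/2`. -/
theorem stmt_18 (n : ℕ) (hn : 3 ≤ n) (t T : Fin n → ℝ) (ht : StrictMono t)
    (M' m' : ℝ) (hMm : M' > m')
    (hT0 : ∀ l : Fin n, 0 < (l : ℕ) → T l < T ⟨0, by omega⟩)
    (hub : ∀ l : Fin n, 0 < (l : ℕ) → T l ≤ M')
    (hlb : ∀ l : Fin n, 0 < (l : ℕ) → m' ≤ T l)
    (i j : Fin n) (hi : 0 < (i : ℕ)) (hij : i < j)
    (hTi : T i = m') (hTj : T j = M') :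
    ∀ f : ℝ → ℝ, StrictAnti f →
      (M' - m') / 2 < ⨆ l : Fin n, |f (t l) - T l| := by
  intro f hf
  have hle : ∀ l : Fin n, |f (t l) - T l| ≤ ⨆ l : Fin n, |f (t l) - T l| :=
    fun l => le_ciSup (f := fun l : Fin n => |f (t l) - T l|) (Set.finite_range _).bddAbove l
  have hfij : f (t j) < f (t i) := hf (ht hij)
  have h_i := (le_abs_self _).trans (hle i)
  have h_j := (neg_le_abs _).trans (hle j)
  linarith
end

section
/- Let f and g be two distinct functions, each of the form t ↦ a·exp(k·t)+b with a,b ∈ ℝ and k ≠ 0, and suppose there are α < β with f(α) = g(α), f(β) = g(β) and f(α) > f(β). Then the following are equivalent: (1) g(γ) < f(γ) for some γ ∈ (α,β); (2) g(γ) < f(γ) for every γ ∈ (α,β); (3) g(γ) > f(γ) for some γ ∈ (−∞,α)∪(β,∞); (4) g(γ) > f(γ) for every γ ∈ (−∞,α)∪(β,∞). -/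
open Real

theorem strictMono_exp_mul_div {k : ℝ} (hk : k ≠ 0) : StrictMono fun t => exp (k * t) / k := by
  intro x y hxy
  rcases hk.lt_or_gt with hk | hk
  · exact div_lt_div_of_neg_of_lt hk (exp_lt_exp.2 (mul_lt_mul_of_neg_left hxy hk))
  · exact div_lt_div_of_pos_right (exp_lt_exp.2 (mul_lt_mul_of_pos_left hxy hk)) hk

/-- Chord slopes of a difference of exponentials, measured against `exp (k * t) / k`,
strictly increase. -/
theorem exp_sub_exp_slope_lt {a b c d k l : ℝ} (hk : k ≠ 0) (hkl : k < l) (hcl : c * l < 0)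
    {x y z : ℝ} (hxy : x < y) (hyz : y < z) (h : ℝ → ℝ)
    (hh : h = fun t => (a * exp (k * t) + b) - (c * exp (l * t) + d)) :
    (h y - h x) * (exp (k * z) / k - exp (k * y) / k) <
      (h z - h y) * (exp (k * y) / k - exp (k * x) / k) := by
  have hE : ∀ t, HasDerivAt (fun t => exp (k * t) / k) (exp (k * t)) t := fun t => by
    refine (((hasDerivAt_id t).const_mul k).exp.div_const k).congr_deriv ?_
    simp [hk]
  have hh' : ∀ t, HasDerivAt h (exp (k * t) * (a * k - c * l * exp ((l - k) * t))) t := fun t => by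
    have h₁ := ((((hasDerivAt_id t).const_mul k).exp).const_mul a).add_const b
    have h₂ := ((((hasDerivAt_id t).const_mul l).exp).const_mul c).add_const d
    rw [hh]
    refine (h₁.sub h₂).congr_deriv ?_
    have : exp (l * t) = exp (k * t) * exp ((l - k) * t) := by
      rw [← exp_add]; ring_nf
    simp only [id, this]
    ring
  have hmono := strictMono_exp_mul_div hk
  have slope : ∀ {u v : ℝ}, u < v → ∃ p ∈ Set.Ioo u v,
      h v - h u = (a * k - c * l * exp ((l - k) * p)) * (exp (k * v) / k - exp (k * u) / k) := by
    intro u v huv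
    obtain ⟨p, hp, e⟩ := exists_ratio_hasDerivAt_eq_ratio_slope h _ huv
      (fun t _ => (hh' t).continuousAt.continuousWithinAt) (fun t _ => hh' t)
      (fun t => exp (k * t) / k) _
      (fun t _ => (hE t).continuousAt.continuousWithinAt) (fun t _ => hE t)
    refine ⟨p, hp, mul_right_cancel₀ (exp_pos (k * p)).ne' ?_⟩
    linear_combination -e
  obtain ⟨p, hp, ep⟩ := slope hxy
  obtain ⟨q, hq, eq⟩ := slope hyz
  have hpq : exp ((l - k) * p) < exp ((l - k) * q) :=
    exp_lt_exp.2 (mul_lt_mul_of_pos_left (hp.2.trans hq.1) (sub_pos.2 hkl))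
  have hpos := mul_pos (sub_pos.2 (hmono hxy)) (sub_pos.2 (hmono hyz))
  rw [ep, eq]
  have := mul_pos (mul_pos_of_neg_of_neg hcl (sub_neg.2 hpq)) hpos
  linear_combination this

/-- Two exponentials agreeing at two points, the one with the larger rate being decreasing:
it lies above the other one between these points and below it outside. -/
theorem exp_crossing {a b c d k l : ℝ} (hk : k ≠ 0) (hkl : k < l) (hcl : c * l < 0)
    {f g : ℝ → ℝ} (hf : f = fun t => a * exp (k * t) + b) (hg : g = fun t => c * exp (l * t) + d)
    {α β : ℝ} (hαβ : α < β) (e₁ : f α = g α) (e₂ : f β = g β) :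
    (∀ γ ∈ Set.Ioo α β, f γ < g γ) ∧ ∀ γ ∈ Set.Iio α ∪ Set.Ioi β, g γ < f γ := by
  have slope := fun {x y z : ℝ} (hxy : x < y) (hyz : y < z) =>
    exp_sub_exp_slope_lt (a := a) (b := b) (d := d) hk hkl hcl hxy hyz (fun t => f t - g t)
      (by rw [hf, hg])
  have hE := strictMono_exp_mul_div hk hαβ
  have hα := sub_eq_zero.2 e₁
  have hβ := sub_eq_zero.2 e₂
  refine ⟨fun γ hγ => ?_, ?_⟩
  · have h := slope hγ.1 hγ.2
    simp only [hα, hβ] at h hE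
    nlinarith
  · rintro γ (hγ | hγ)
    · have h := slope hγ hαβ
      simp only [hα, hβ] at h hE
      nlinarith
    · have h := slope hαβ hγ
      simp only [hα, hβ] at h hE
      nlinarith

theorem mul_neg_of_exp_lt {c d l α β : ℝ} (hαβ : α < β)
    (h : c * exp (l * β) + d < c * exp (l * α) + d) : c * l < 0 := by
  rcases lt_trichotomy l 0 with hl | rfl | hl
  · have := exp_lt_exp.2 (mul_lt_mul_of_neg_left hαβ hl)
    exact mul_neg_of_pos_of_neg (by nlinarith) hl
  · simp at h
  · have := exp_lt_exp.2 (mul_lt_mul_of_pos_left hαβ hl)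
    exact mul_neg_of_neg_of_pos (by nlinarith) hl

/-- Let `f ≠ g` be exponentials agreeing at `α < β` with `f(α) > f(β)`.
Then the following are equivalent: (1) `g < f` somewhere in `(α,β)`;
(2) `g < f` everywhere in `(α,β)`; (3) `g > f` somewhere outside `[α,β]`;
(4) `g > f` everywhere outside `[α,β]`. -/
theorem stmt_19 (f g : ℝ → ℝ) (hf : IsExp f) (hg : IsExp g) (hfg : f ≠ g)
    (α β : ℝ) (hαβ : α < β)
    (e₁ : f α = g α) (e₂ : f β = g β) (hdec : f β < f α) :
    List.TFAE [
      ∃ γ ∈ Set.Ioo α β, g γ < f γ,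
      ∀ γ ∈ Set.Ioo α β, g γ < f γ,
      ∃ γ ∈ Set.Iio α ∪ Set.Ioi β, f γ < g γ,
      ∀ γ ∈ Set.Iio α ∪ Set.Ioi β, f γ < g γ] := by
  have hin : ((α + β) / 2) ∈ Set.Ioo α β := ⟨by linarith, by linarith⟩
  have hout : β + 1 ∈ Set.Iio α ∪ Set.Ioi β := Or.inr (lt_add_one β)
  obtain ⟨a, b, k, hk, hf⟩ := hf
  obtain ⟨c, d, l, hl, hg⟩ := hg
  have hak : a * k < 0 := mul_neg_of_exp_lt (d := b) hαβ (by simpa only [hf] using hdec)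
  have hcl : c * l < 0 := by
    rw [e₁, e₂] at hdec
    exact mul_neg_of_exp_lt (d := d) hαβ (by simpa only [hg] using hdec)
  rcases lt_trichotomy k l with hkl | rfl | hkl
  · obtain ⟨hi, ho⟩ := exp_crossing hk hkl hcl hf hg hαβ e₁ e₂
    apply List.tfae_of_forall False
    simp only [List.mem_cons, List.not_mem_nil, or_false, forall_eq_or_imp, forall_eq, iff_false]
    exact ⟨fun ⟨γ, hγ, h⟩ => h.asymm (hi γ hγ), fun h => (h _ hin).asymm (hi _ hin),
      fun ⟨γ, hγ, h⟩ => h.asymm (ho γ hγ), fun h => (h _ hout).asymm (ho _ hout)⟩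
  · refine absurd ?_ hfg
    have hne : exp (k * α) - exp (k * β) ≠ 0 := by
      simpa [sub_eq_zero, hk] using hαβ.ne
    simp only [hf, hg] at e₁ e₂
    obtain rfl : a = c := mul_right_cancel₀ hne (by linear_combination e₁ - e₂)
    obtain rfl : b = d := by linarith
    rw [hf, hg]
  · obtain ⟨hi, ho⟩ := exp_crossing hl hkl hak hg hf hαβ e₁.symm e₂.symm
    apply List.tfae_of_forall True
    simp only [List.mem_cons, List.not_mem_nil, or_false, forall_eq_or_imp, forall_eq, iff_true]
    exact ⟨⟨_, hin, hi _ hin⟩, hi, ⟨_, hout, ho _ hout⟩, ho⟩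
end
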